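/- Let f : ℝ → ℝ be a three-times differentiable function satisfying det [[1,1,1],[f(x),f(y),f(z)],[f'(x),f'(y),f'(z)]] = 0 for all real x, y, z with x + y + z = 0. Then there exist functions F, G : ℝ → ℝ with F differentiable, F' = f, and F(x)F(y) + F(y)F(z) + F(z)F(x) = G(x) + G(y) + G(z) for all real x, y, z with x + y + z = 0. -/

import Mathlib

open Set Filter Topology

/-- The determinant condition for `f` with derivative `g`, in expanded form. -/
def DetVanishes (f g : ℝ → ℝ) : Prop :=
  ∀ x y z : ℝ, x + y + z = 0 →
    f x * (g y - g z) + f y * (g z - g x) + f z * (g x - g y) = 0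

namespace DetVanishes

variable {f g h : ℝ → ℝ}

lemma hasDerivAt_comp_neg_sub {φ φ' : ℝ → ℝ} (hφ : ∀ x, HasDerivAt φ (φ' x) x) (a y : ℝ) :
    HasDerivAt (fun t => φ (-a - t)) (-φ' (-a - y)) y := by
  have h1 : HasDerivAt (fun t : ℝ => -a - t) (-1) y := by
    simpa using (hasDerivAt_id y).const_sub (-a)
  have h2 := (hφ (-a - y)).comp y h1
  simpa [Function.comp_def] using h2

/-- Derivative of the determinant in the direction that fixes the last variable. -/
lemma deriv_eq_zero (hf : ∀ x, HasDerivAt f (g x) x) (hg : ∀ x, HasDerivAt g (h x) x)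
    (H : DetVanishes f g) {x y z : ℝ} (hs : x + y + z = 0) :
    h x * (f y - f z) + h y * (f x - f z) + g z * (g x + g y) - 2 * g x * g y = 0 := by
  obtain rfl : x = -z - y := by linarith
  have e : (fun t => f (-z - t) * (g t - g z) + f t * (g z - g (-z - t))
      + f z * (g (-z - t) - g t)) = fun _ => 0 := by
    funext t
    exact H _ _ _ (by ring)
  have F := hasDerivAt_comp_neg_sub hf z y
  have G := hasDerivAt_comp_neg_sub hg z y
  have d := ((F.mul ((hg y).sub_const (g z))).add ((hf y).mul (G.const_sub (g z)))).add
    ((G.sub (hg y)).const_mul (f z))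
  have d0 : HasDerivAt (fun t => f (-z - t) * (g t - g z) + f t * (g z - g (-z - t))
      + f z * (g (-z - t) - g t)) 0 y := by
    rw [e]; exact hasDerivAt_const y 0
  have := d.unique d0
  linarith

/-- At a critical point `x₀`, the reflection `y ↦ -x₀ - y` sends points off the level of `x₀`
to points on it. -/
lemma eq_or_eq_of_critical (hf : ∀ x, HasDerivAt f (g x) x) (H : DetVanishes f g)
    {x₀ : ℝ} (h0 : g x₀ = 0) (y : ℝ) : f y = f x₀ ∨ f (-x₀ - y) = f x₀ := by
  have d : ∀ t, HasDerivAt (fun t => (f t - f x₀) * (f (-x₀ - t) - f x₀)) 0 t := by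
    intro t
    have := ((hf t).sub_const (f x₀)).mul
      ((hasDerivAt_comp_neg_sub hf x₀ t).sub_const (f x₀))
    refine this.congr_deriv ?_
    have := H x₀ t (-x₀ - t) (by ring)
    rw [h0] at this
    linarith
  have := is_const_of_deriv_eq_zero (fun t => (d t).differentiableAt) (fun t => (d t).deriv) y x₀
  simp only [sub_self, zero_mul, mul_eq_zero, sub_eq_zero] at this
  exact this

/-- If an open set is dense in an interval, any reflection of the interval that meets it
maps some point of the set into the set. -/
lemma exists_mem_mem_of_dense {V : Set ℝ} (hV : IsOpen V) {s t : ℝ}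
    (hd : Ioo s t ⊆ closure V) {φ : ℝ → ℝ} (hφ : Continuous φ) {m : ℝ} (hm : m ∈ Ioo s t)
    (hφm : φ m ∈ Ioo s t) (hφo : IsOpenMap φ) : ∃ v ∈ V, φ v ∈ V := by
  obtain ⟨w, ⟨hw1, hw2⟩, hwV⟩ := mem_closure_iff.1 (hd hm) (Ioo s t ∩ φ ⁻¹' Ioo s t)
    (isOpen_Ioo.inter (isOpen_Ioo.preimage hφ)) ⟨hm, hφm⟩
  obtain ⟨_, ⟨v, hv, rfl⟩, hv'⟩ := mem_closure_iff.1 (hd hw2) (φ '' V) (hφo _ hV) ⟨w, hwV, rfl⟩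
  exact ⟨v, hv, hv'⟩

/-- A solution with a critical point is constant. -/
lemma eq_of_critical (hf : ∀ x, HasDerivAt f (g x) x) (H : DetVanishes f g)
    {x₀ : ℝ} (h0 : g x₀ = 0) (v₁ : ℝ) : f v₁ = f x₀ := by
  by_contra hv₁
  have hc : Continuous f := continuous_iff_continuousAt.2 fun x => (hf x).continuousAt
  set V : Set ℝ := {v | f v ≠ f x₀} with hVdef
  have hV : IsOpen V := isOpen_ne_fun hc continuous_const
  have key : ∀ z, f z = f x₀ → g z = 0 → ∀ y ∈ V, -z - y ∉ V := by
    intro z hz hz' y hy hy'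
    rcases eq_or_eq_of_critical hf H hz' y with h | h
    · exact hy (h.trans hz)
    · exact hy' (h.trans hz)
  have sumfree : ∀ v ∈ V, ∀ y ∈ V, x₀ + v - y ∉ V := by
    intro v hv y hy
    have hcl : ∀ w ∈ V, f (-x₀ - w) = f x₀ := fun w hw =>
      not_not.1 (key x₀ rfl h0 w hw)
    have hev : (fun t => f (-x₀ - t)) =ᶠ[𝓝 v] fun _ => f x₀ :=
      Filter.mem_of_superset (hV.mem_nhds hv) hcl
    have hd := (hasDerivAt_comp_neg_sub hf x₀ v).unique
      ((hasDerivAt_const v (f x₀)).congr_of_eventuallyEq hev)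
    have := key (-x₀ - v) (hcl v hv) (by linarith) y hy
    rwa [show -(-x₀ - v) - y = x₀ + v - y by ring] at this
  have grow : ∀ s t, Ioo s t ⊆ closure V → Ioo (-2 * t) (-2 * s) ⊆ closure V := by
    intro s t hst p hp
    have hm : -p / 2 ∈ Ioo s t := ⟨by linarith [hp.2], by linarith [hp.1]⟩
    obtain ⟨v, hv, hv'⟩ := exists_mem_mem_of_dense hV hst (φ := fun v => -p - v) (by fun_prop) hm
      (by simpa [show -p - -p / 2 = -p / 2 by ring] using hm)
      (Homeomorph.subLeft (-p)).isOpenMap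
    by_cases hpV : f p = f x₀
    · have hgp : g p ≠ 0 := fun h => key p hpV h v hv hv'
      rw [mem_closure_iff_frequently]
      exact ((hf p).eventually_ne (c := f x₀) hgp).frequently.filter_mono nhdsWithin_le_nhds
    · exact subset_closure hpV
  obtain ⟨ε, hε, hball⟩ := Metric.isOpen_iff.1 hV v₁ hv₁
  have large : ∀ n : ℕ, ∃ s t, ε * 2 ^ n ≤ t - s ∧ Ioo s t ⊆ closure V := by
    intro n
    induction n with
    | zero =>
      refine ⟨v₁ - ε, v₁ + ε, by linarith, ?_⟩
      rw [← Real.ball_eq_Ioo]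
      exact hball.trans subset_closure
    | succ n ih =>
      obtain ⟨s, t, hl, hd⟩ := ih
      exact ⟨_, _, by rw [pow_succ]; linarith, grow s t hd⟩
  obtain ⟨n, hn⟩ := pow_unbounded_of_one_lt (|v₁ - x₀| / ε) (one_lt_two)
  obtain ⟨s, t, hl, hd⟩ := large n
  have hlen : |v₁ - x₀| < t - s := by
    rw [div_lt_iff₀ hε] at hn
    linarith
  obtain ⟨hl1, hl2⟩ := abs_lt.1 hlen
  obtain ⟨v, hv, hv'⟩ := exists_mem_mem_of_dense hV hd (φ := fun v => v + (v₁ - x₀))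
    (by fun_prop) (m := (s + t) / 2 - (v₁ - x₀) / 2) ⟨by linarith, by linarith⟩
    ⟨by linarith, by linarith⟩ (Homeomorph.addRight (v₁ - x₀)).isOpenMap
  have := sumfree _ hv' v₁ hv₁
  rw [show x₀ + (v + (v₁ - x₀)) - v₁ = v by ring] at this
  exact this hv

lemma injective_of_ne_zero (hf : ∀ x, HasDerivAt f (g x) x) (hne : ∀ x, g x ≠ 0) :
    Function.Injective f := by
  have : ∀ x y, x < y → f x ≠ f y := by
    intro x y hxy e
    obtain ⟨c, -, hc⟩ := exists_hasDerivAt_eq_zero hxy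
      (fun t _ => (hf t).continuousAt.continuousWithinAt) e (fun t _ => hf t)
    exact hne c hc
  intro x y e
  rcases lt_trichotomy x y with h | h | h
  · exact absurd e (this _ _ h)
  · exact h
  · exact absurd e.symm (this _ _ h)

lemma eq_of_hasDerivAt_zero_of_convex {φ : ℝ → ℝ} {s : Set ℝ} (hs : Convex ℝ s)
    (hd : ∀ x ∈ s, HasDerivAt φ 0 x) {a b : ℝ} (ha : a ∈ s) (hb : b ∈ s) : φ a = φ b := by
  have := hs.norm_image_sub_le_of_norm_hasDerivWithin_le (C := 0) (f' := fun _ => 0)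
    (fun x hx => (hd x hx).hasDerivWithinAt) (by simp) hb ha
  simpa [sub_eq_zero] using this

/-- A function on the sector `x > y > -x - y` with vanishing partial derivatives is constant. -/
lemma exists_const_of_partials_eq_zero {K : ℝ → ℝ → ℝ}
    (hx : ∀ x y, y < x → -x - y < y → HasDerivAt (fun t => K t y) 0 x)
    (hy : ∀ x y, y < x → -x - y < y → HasDerivAt (fun t => K x t) 0 y) :
    ∃ c, ∀ x y, y < x → -x - y < y → K x y = c := by
  have up : ∀ x x' y, y < x → -x - y < y → x ≤ x' → K x y = K x' y := by
    intro x x' y h1 h2 h3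
    exact eq_of_hasDerivAt_zero_of_convex (convex_Ici x)
      (fun t (ht : x ≤ t) => hx t y (by linarith) (by linarith)) self_mem_Ici h3
  refine ⟨K 1 0, fun x y h1 h2 => ?_⟩
  rw [up x (max x 1) y h1 h2 (le_max_left _ _),
    up 1 (max x 1) 0 (by norm_num) (by norm_num) (le_max_right _ _)]
  have hX : 0 < max x 1 := lt_max_of_lt_right one_pos
  have hxX := le_max_left x 1
  generalize max x 1 = X at *
  exact eq_of_hasDerivAt_zero_of_convex (convex_Ioo (-X / 2) X)
    (fun t ht => hy X t ht.2 (by linarith [ht.1])) ⟨by linarith, by linarith⟩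
    ⟨by linarith, by linarith⟩

/-- Slope of the line through the points of the phase curve `(f, g)` over `x` and `y`. -/
noncomputable def chordSlope (f g : ℝ → ℝ) (x y : ℝ) : ℝ := (g x - g y) / (f x - f y)

/-- The quantity relating the derivative of the chord slope to the differences of `f`. -/
noncomputable def slopeRate (f g h : ℝ → ℝ) (x y : ℝ) : ℝ :=
  (h x - chordSlope f g x y * g x) / ((f x - f y) * (f x - f (-x - y)))

lemma chordSlope_comm (f g : ℝ → ℝ) (x y : ℝ) : chordSlope f g x y = chordSlope f g y x := by
  rw [chordSlope, chordSlope, ← neg_sub (g y), ← neg_sub (f y), neg_div_neg_eq]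

lemma chordSlope_mul {x y : ℝ} (hxy : f x ≠ f y) :
    g x - g y = chordSlope f g x y * (f x - f y) :=
  (div_mul_cancel₀ _ (sub_ne_zero.2 hxy)).symm

lemma chordSlope_mul_third (H : DetVanishes f g) {x y z : ℝ} (hs : x + y + z = 0)
    (hxy : f x ≠ f y) : g x - g z = chordSlope f g x y * (f x - f z) := by
  have := H x y z hs
  rw [chordSlope, div_mul_eq_mul_div, eq_div_iff (sub_ne_zero.2 hxy)]
  linarith

lemma rate_relation (hf : ∀ x, HasDerivAt f (g x) x) (hg : ∀ x, HasDerivAt g (h x) x)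
    (H : DetVanishes f g) {x y z : ℝ} (hs : x + y + z = 0) (hxy : f x ≠ f y) :
    (h x - chordSlope f g x y * g x) * (f y - f z)
      + (h y - chordSlope f g x y * g y) * (f x - f z) = 0 := by
  have e := deriv_eq_zero hf hg H hs
  have e1 := chordSlope_mul (g := g) hxy
  have e2 := chordSlope_mul_third H hs hxy
  linear_combination e + g x * (e2 - e1) + g y * e2

lemma slopeRate_comm (hf : ∀ x, HasDerivAt f (g x) x) (hg : ∀ x, HasDerivAt g (h x) x)
    (H : DetVanishes f g) {x y : ℝ} (hxy : f x ≠ f y) (hxz : f x ≠ f (-x - y))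
    (hyz : f y ≠ f (-x - y)) : slopeRate f g h x y = slopeRate f g h y x := by
  have e := rate_relation hf hg H (z := -x - y) (by ring) hxy
  rw [slopeRate, slopeRate, chordSlope_comm f g y x, show -y - x = -x - y by ring, div_eq_div_iff
    (mul_ne_zero (sub_ne_zero.2 hxy) (sub_ne_zero.2 hxz))
    (mul_ne_zero (sub_ne_zero.2 hxy.symm) (sub_ne_zero.2 hyz))]
  linear_combination (f y - f x) * e

lemma hasDerivAt_chordSlope (hf : ∀ x, HasDerivAt f (g x) x) (hg : ∀ x, HasDerivAt g (h x) x)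
    {x y : ℝ} (hxy : f x ≠ f y) :
    HasDerivAt (fun t => chordSlope f g x t)
      ((chordSlope f g x y * g y - h y) / (f x - f y)) y := by
  have h0 := sub_ne_zero.2 hxy
  refine (((hg y).const_sub (g x)).div ((hf y).const_sub (f x)) h0).congr_deriv ?_
  rw [chordSlope]
  field_simp
  ring

lemma hasDerivAt_slopeRate (hf : ∀ x, HasDerivAt f (g x) x) (hg : ∀ x, HasDerivAt g (h x) x)
    (H : DetVanishes f g) {x y : ℝ} (hxy : f x ≠ f y) (hxz : f x ≠ f (-x - y)) :
    HasDerivAt (fun t => slopeRate f g h x t) 0 y := by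
  have h1 := sub_ne_zero.2 hxy
  have h2 := sub_ne_zero.2 hxz
  have hn := ((hasDerivAt_chordSlope hf hg hxy).mul_const (g x)).const_sub (h x)
  have hd := ((hf y).const_sub (f x)).mul
    ((hasDerivAt_comp_neg_sub hf x y).const_sub (f x))
  refine (hn.div hd (mul_ne_zero h1 h2)).congr_deriv ?_
  simp only [Pi.mul_apply]
  rw [div_eq_zero_iff]
  left
  have e := rate_relation hf hg H (z := -x - y) (by ring) hxy
  have e1 := chordSlope_mul (g := g) hxy
  have e2 := chordSlope_mul_third H (z := -x - y) (by ring) hxy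
  generalize chordSlope f g x y = T at *
  generalize f (-x - y) = c at *
  generalize g (-x - y) = s at *
  obtain rfl : s = g x - T * (f x - c) := by linarith
  have e3 : g y = g x - T * (f x - f y) := by linarith
  field_simp
  rw [e3] at e ⊢
  linear_combination (g x) * e

/-- For an injective solution the chord slope is an affine function of the sum of the values
of an antiderivative. -/
lemma exists_affine_chordSlope (hf : ∀ x, HasDerivAt f (g x) x)
    (hg : ∀ x, HasDerivAt g (h x) x) (H : DetVanishes f g) (hinj : Function.Injective f)
    {F : ℝ → ℝ} (hF : ∀ x, HasDerivAt F (f x) x) :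
    ∃ c d : ℝ, ∀ x y z, x + y + z = 0 →
      g x - g y = (c * (F x + F y + F z) + d) * (f x - f y) := by
  obtain ⟨c, hc⟩ : ∃ c, ∀ x y, y < x → -x - y < y → slopeRate f g h x y = c := by
    refine exists_const_of_partials_eq_zero (fun x y h1 h2 => ?_) (fun x y h1 h2 => ?_)
    · have hd := hasDerivAt_slopeRate hf hg H (x := y) (y := x) (hinj.ne h1.ne)
        (hinj.ne (by linarith : -y - x < y).ne')
      refine hd.congr_of_eventuallyEq ?_
      filter_upwards [Ioi_mem_nhds h1, Ioi_mem_nhds (show -2 * y < x by linarith)] with t ht ht'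
      have ht1 : y < t := ht
      have ht2 : -2 * y < t := ht'
      exact slopeRate_comm hf hg H (hinj.ne ht1.ne')
        (hinj.ne (by linarith : -t - y < t).ne') (hinj.ne (by linarith : -t - y < y).ne')
    · exact hasDerivAt_slopeRate hf hg H (hinj.ne h1.ne') (hinj.ne (h2.trans h1).ne')
  obtain ⟨d, hd⟩ : ∃ d, ∀ x y, y < x → -x - y < y →
      chordSlope f g x y - c * (F x + F y + F (-x - y)) = d := by
    have main : ∀ x y, f x ≠ f y → f y ≠ f (-x - y) → slopeRate f g h y x = c →
        HasDerivAt (fun t => chordSlope f g x t - c * (F x + F t + F (-x - t))) 0 y := by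
      intro x y hxy hyz hr
      have hS := (((hF y).const_add (F x)).add (hasDerivAt_comp_neg_sub hF x y)).const_mul c
      refine ((hasDerivAt_chordSlope hf hg hxy).sub hS).congr_deriv ?_
      rw [slopeRate, show -y - x = -x - y by ring, chordSlope_comm f g y x, div_eq_iff
        (mul_ne_zero (sub_ne_zero.2 hxy.symm) (sub_ne_zero.2 hyz))] at hr
      rw [sub_eq_zero, div_eq_iff (sub_ne_zero.2 hxy)]
      linarith
    refine exists_const_of_partials_eq_zero (fun x y h1 h2 => ?_) (fun x y h1 h2 => ?_)
    · refine (main y x (hinj.ne h1.ne) (hinj.ne (by linarith : -y - x < x).ne')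
        (hc x y h1 h2)).congr_of_eventuallyEq (Eventually.of_forall fun t => ?_)
      simp only
      rw [chordSlope_comm, show -t - y = -y - t by ring]
      ring
    · refine main x y (hinj.ne h1.ne') (hinj.ne h2.ne') ?_
      rw [← slopeRate_comm hf hg H (hinj.ne h1.ne') (hinj.ne (h2.trans h1).ne') (hinj.ne h2.ne')]
      exact hc x y h1 h2
  have sector : ∀ x y z, x + y + z = 0 → y < x → z < y →
      g x - g y = (c * (F x + F y + F z) + d) * (f x - f y) ∧
      g x - g z = (c * (F x + F y + F z) + d) * (f x - f z) := by
    intro x y z hs h1 h2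
    have e : chordSlope f g x y = c * (F x + F y + F z) + d := by
      have := hd x y h1 (by linarith)
      rw [show -x - y = z by linarith] at this
      linarith
    rw [← e]
    exact ⟨chordSlope_mul (hinj.ne h1.ne'), chordSlope_mul_third H hs (hinj.ne h1.ne')⟩
  have distinct : ∀ x y z, x + y + z = 0 → x ≠ y → x ≠ z → y ≠ z →
      g x - g y = (c * (F x + F y + F z) + d) * (f x - f y) := by
    intro x y z hs hxy hxz hyz
    rcases hxy.lt_or_gt with a | a <;> rcases hxz.lt_or_gt with b | b <;>
      rcases hyz.lt_or_gt with e | e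
    · linarith [sector z y x (by linarith) e a]
    · linarith [sector y z x (by linarith) e b]
    · linarith
    · linarith [sector y x z (by linarith) a b]
    · linarith [sector z x y (by linarith) b a]
    · linarith
    · linarith [sector x z y (by linarith) b e]
    · linarith [sector x y z (by linarith) a e]
  refine ⟨c, d, fun x y z hs => ?_⟩
  obtain rfl : z = -x - y := by linarith
  have cf : Continuous f := continuous_iff_continuousAt.2 fun x => (hf x).continuousAt
  have cg : Continuous g := continuous_iff_continuousAt.2 fun x => (hg x).continuousAt
  have cF : Continuous F := continuous_iff_continuousAt.2 fun x => (hF x).continuousAt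
  have hdense : Dense ({x, -x / 2, -2 * x} : Set ℝ)ᶜ := (Set.toFinite _).countable.dense_compl ℝ
  have := Continuous.ext_on hdense (f := fun t => g x - g t)
    (g := fun t => (c * (F x + F t + F (-x - t)) + d) * (f x - f t))
    (by fun_prop) (by fun_prop) (by
      intro t ht
      simp only [mem_compl_iff, mem_insert_iff, mem_singleton_iff, not_or] at ht
      obtain ⟨t1, t2, t3⟩ := ht
      exact distinct x t (-x - t) (by ring) (Ne.symm t1) (fun h => t3 (by linarith))
        (fun h => t2 (by linarith)))
  exact congrFun this y

end DetVanishes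

open DetVanishes

/-- `F` and some `G` satisfy the factored functional equation. -/
def HasFactoredSum (F : ℝ → ℝ) : Prop :=
  ∃ G : ℝ → ℝ, ∀ x y z : ℝ, x + y + z = 0 →
    F x * F y + F y * F z + F z * F x = G x + G y + G z

lemma hasFactoredSum_of_chord {f g F : ℝ → ℝ} (hf : ∀ x, HasDerivAt f (g x) x)
    (hF : ∀ x, HasDerivAt F (f x) x) {k : ℝ}
    (hk : ∀ x y z, x + y + z = 0 → (F x + F y + F z) * (f x - f y) = k * (g x - g y)) :
    HasFactoredSum F := by
  set E : ℝ → ℝ → ℝ := fun x y =>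
    (F x + F y + F (-x - y)) ^ 2 / 2 - k * (f x + f y + f (-x - y)) with hE
  have hd : ∀ x y, HasDerivAt (fun t => E x t) 0 y := by
    intro x y
    have h1 := (((hF y).const_add (F x)).add (hasDerivAt_comp_neg_sub hF x y))
    have h2 := (((hf y).const_add (f x)).add (hasDerivAt_comp_neg_sub hf x y)).const_mul k
    refine (((h1.pow 2).div_const 2).sub h2).congr_deriv ?_
    have := hk y (-x - y) x (by ring)
    simp only [Pi.add_apply]
    push_cast
    linear_combination this
  have hcst : ∀ x y y', E x y = E x y' := fun x =>
    is_const_of_deriv_eq_zero (fun t => (hd x t).differentiableAt) (fun t => (hd x t).deriv)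
  have hsymm : ∀ x y, E x y = E y x := by
    intro x y
    simp only [hE]
    rw [show -y - x = -x - y by ring]
    ring
  refine ⟨fun x => k * f x - F x ^ 2 / 2 + E 0 0 / 3, fun x y z hs => ?_⟩
  have e : E x y = E 0 0 := by rw [hcst x y 0, hsymm, hcst 0 x 0]
  obtain rfl : z = -x - y := by linarith
  generalize E 0 0 = m at *
  simp only [hE] at e
  linear_combination e

/-- Solutions of a first-order affine equation have an antiderivative with factored sum. -/
lemma exists_hasFactoredSum_of_affine {f g : ℝ → ℝ} (hf : ∀ x, HasDerivAt f (g x) x) {d b : ℝ}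
    (hg : ∀ x, g x = d * f x + b) :
    ∃ F : ℝ → ℝ, (∀ x, HasDerivAt F (f x) x) ∧ HasFactoredSum F := by
  rcases eq_or_ne d 0 with rfl | hd
  · have hlin : ∀ x, f x = f 0 + b * x := by
      have : ∀ t, HasDerivAt (fun t => f t - b * t) 0 t := fun t =>
        ((hf t).sub ((hasDerivAt_id t).const_mul b)).congr_deriv (by rw [hg]; ring)
      intro x
      have := is_const_of_deriv_eq_zero (fun t => (this t).differentiableAt)
        (fun t => (this t).deriv) x 0
      linarith
    refine ⟨fun x => f 0 * x + b * x ^ 2 / 2, fun x => ?_,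
      fun x => - f 0 ^ 2 * x ^ 2 / 2 - f 0 * b * x ^ 3 / 2 + b ^ 2 * x ^ 4 / 8, ?_⟩
    · refine (((hasDerivAt_id x).const_mul (f 0)).add
        ((((hasDerivAt_id x).pow 2).const_mul b).div_const 2)).congr_deriv ?_
      rw [hlin x]
      simp
      ring
    · intro x y z hs
      obtain rfl : z = -x - y := by linarith
      ring
  · set C : ℝ := f 0 + b / d with hC
    have hexp : ∀ x, f x = C * Real.exp (d * x) - b / d := by
      have : ∀ t, HasDerivAt (fun t => (f t + b / d) * Real.exp (-(d * t))) 0 t := by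
        intro t
        have h1 : HasDerivAt (fun t => Real.exp (-(d * t))) (Real.exp (-(d * t)) * -(d * 1)) t :=
          (((hasDerivAt_id t).const_mul d).neg).exp
        refine (((hf t).add_const (b / d)).mul h1).congr_deriv ?_
        rw [hg]
        field_simp
        ring
      intro x
      have := is_const_of_deriv_eq_zero (fun t => (this t).differentiableAt)
        (fun t => (this t).deriv) x 0
      simp only [mul_zero, neg_zero, Real.exp_zero, mul_one] at this
      rw [hC, ← this, mul_assoc, ← Real.exp_add]
      simp
    refine ⟨fun x => C / d * Real.exp (d * x) - b / d * x, fun x => ?_,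
      fun x => (C / d) ^ 2 * Real.exp (-(d * x)) + C / d * (b / d) * x * Real.exp (d * x)
        - (b / d) ^ 2 * x ^ 2 / 2, ?_⟩
    · have h1 : HasDerivAt (fun t => Real.exp (d * t)) (Real.exp (d * x) * (d * 1)) x :=
        ((hasDerivAt_id x).const_mul d).exp
      refine ((h1.const_mul (C / d)).sub ((hasDerivAt_id x).const_mul (b / d))).congr_deriv ?_
      rw [hexp x]
      field_simp
    · intro x y z hs
      have key : ∀ u v w : ℝ, u + v + w = 0 →
          Real.exp (-(d * u)) = Real.exp (d * v) * Real.exp (d * w) := by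
        intro u v w h
        rw [← Real.exp_add]
        congr 1
        linear_combination (-d) * h
      simp only
      rw [key x y z hs, key y z x (by linarith), key z x y (by linarith)]
      obtain rfl : z = -x - y := by linarith
      ring

theorem stmt_17 (f : ℝ → ℝ)
    (hf1 : Differentiable ℝ f) (hf2 : Differentiable ℝ (deriv f))
    (hf3 : Differentiable ℝ (deriv (deriv f)))
    (heq : ∀ x y z : ℝ, x + y + z = 0 →
      Matrix.det !![(1 : ℝ), 1, 1; f x, f y, f z; deriv f x, deriv f y, deriv f z] = 0) :
    ∃ F G : ℝ → ℝ, Differentiable ℝ F ∧ deriv F = f ∧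
      ∀ x y z : ℝ, x + y + z = 0 →
        F x * F y + F y * F z + F z * F x = G x + G y + G z := by
  suffices ∃ F : ℝ → ℝ, (∀ x, HasDerivAt F (f x) x) ∧ HasFactoredSum F by
    obtain ⟨F, hF, G, hG⟩ := this
    exact ⟨F, G, fun x => (hF x).differentiableAt, funext fun x => (hF x).deriv, hG⟩
  have hf : ∀ x, HasDerivAt f (deriv f x) x := fun x => (hf1 x).hasDerivAt
  have hg : ∀ x, HasDerivAt (deriv f) (deriv (deriv f) x) x := fun x => (hf2 x).hasDerivAt
  have H : DetVanishes f (deriv f) := by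
    intro x y z hs
    have := heq x y z hs
    simp [Matrix.det_fin_three] at this
    linarith
  by_cases hcrit : ∃ x₀, deriv f x₀ = 0
  · obtain ⟨x₀, h0⟩ := hcrit
    have hconst : f = fun _ => f x₀ := funext fun v => eq_of_critical hf H h0 v
    refine exists_hasFactoredSum_of_affine hf (d := 0) (b := 0) fun x => ?_
    rw [hconst]
    simp
  · push Not at hcrit
    have hinj := injective_of_ne_zero hf hcrit
    have hF : ∀ x, HasDerivAt (fun u => ∫ t in (0 : ℝ)..u, f t) (f x) x := fun x =>
      (hf1.continuous.integral_hasStrictDerivAt 0 x).hasDerivAt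
    obtain ⟨c, d, hcd⟩ := exists_affine_chordSlope hf hg H hinj hF
    rcases eq_or_ne c 0 with rfl | hc
    · refine exists_hasFactoredSum_of_affine hf (d := d) (b := deriv f 0 - d * f 0) fun x => ?_
      have := hcd x 0 (-x) (by ring)
      linarith
    · refine ⟨fun u => (∫ t in (0 : ℝ)..u, f t) + d / (3 * c), fun x => (hF x).add_const _,
        hasFactoredSum_of_chord (k := 1 / c) hf (fun x => (hF x).add_const _) fun x y z hs => ?_⟩
      rw [hcd x y z hs]
      field_simp
      ring
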